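/- arXiv:2307.07455 — 2 statements merged into one kernel-verified Lean document; each statement's English description precedes it below -/
import Mathlib

section
/- Every expression is semantically equal (i.e., has the same value under every valuation) to some expression in conjunctive normal form, and also to some expression in disjunctive normal form. -/
namespace RESpaper

noncomputable section

/-- Addition on the extended reals in which `⊤` (i.e. `∞`) dominates. -/
def eadd (x y : EReal) : EReal := if x = ⊤ ∨ y = ⊤ then ⊤ else x + y

/-- The operator `eq-∞`. -/
def eqNegInfVal (x : EReal) : EReal := if x = ⊥ then ⊥ else ⊤

/-- The operator `eq∞`. -/
def eqInfVal (x : EReal) : EReal := if x = ⊤ then ⊤ else ⊥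

open Classical in
/-- The sum, with respect to `eadd`, of a finite family of extended reals. -/
def eSum {ι : Type*} (s : Finset ι) (e : ι → EReal) : EReal :=
  if ∃ i ∈ s, e i = ⊤ then ⊤ else ∑ i ∈ s, e i

/-- Syntax of expressions over a set `V` of variables. -/
inductive Expr (V : Type*) where
  | var : V → Expr V
  | const : EReal → Expr V
  | scale : {c : ℝ // 0 < c} → Expr V → Expr V
  | add : Expr V → Expr V → Expr V
  | emin : Expr V → Expr V → Expr V
  | emax : Expr V → Expr V → Expr V
  | condL : Expr V → Expr V → Expr V → Expr V   -- (e₁ ⇒ e₂ ◇ e₃)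
  | condR : Expr V → Expr V → Expr V → Expr V   -- (e₁ → e₂ ◇ e₃)
  | eqm : Expr V → Expr V                       -- eq-∞(e)

variable {V : Type*}

/-- Evaluation of an expression under a valuation `η`. -/
def Expr.eval (η : V → EReal) : Expr V → EReal
  | var X => η X
  | const d => d
  | scale c e => (c.1 : EReal) * Expr.eval η e
  | add e₁ e₂ => eadd (Expr.eval η e₁) (Expr.eval η e₂)
  | emin e₁ e₂ => Expr.eval η e₁ ⊓ Expr.eval η e₂
  | emax e₁ e₂ => Expr.eval η e₁ ⊔ Expr.eval η e₂
  | condL e₁ e₂ e₃ =>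
      if Expr.eval η e₁ ≤ 0 then Expr.eval η e₂ ⊓ Expr.eval η e₃ else Expr.eval η e₃
  | condR e₁ e₂ e₃ =>
      if Expr.eval η e₁ < 0 then Expr.eval η e₂ else Expr.eval η e₂ ⊔ Expr.eval η e₃
  | eqm e => eqNegInfVal (Expr.eval η e)

/-- The set of variables occurring in an expression. -/
def Expr.occ : Expr V → Set V
  | var X => {X}
  | const _ => ∅
  | scale _ e => Expr.occ e
  | add e₁ e₂ => Expr.occ e₁ ∪ Expr.occ e₂
  | emin e₁ e₂ => Expr.occ e₁ ∪ Expr.occ e₂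
  | emax e₁ e₂ => Expr.occ e₁ ∪ Expr.occ e₂
  | condL e₁ e₂ e₃ => Expr.occ e₁ ∪ Expr.occ e₂ ∪ Expr.occ e₃
  | condR e₁ e₂ e₃ => Expr.occ e₁ ∪ Expr.occ e₂ ∪ Expr.occ e₃
  | eqm e => Expr.occ e

/-- `e` contains no occurrence of the conditional operators. -/
def Expr.noCond : Expr V → Prop
  | var _ => True
  | const _ => True
  | scale _ e => Expr.noCond e
  | add e₁ e₂ => Expr.noCond e₁ ∧ Expr.noCond e₂
  | emin e₁ e₂ => Expr.noCond e₁ ∧ Expr.noCond e₂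
  | emax e₁ e₂ => Expr.noCond e₁ ∧ Expr.noCond e₂
  | condL _ _ _ => False
  | condR _ _ _ => False
  | eqm e => Expr.noCond e

/-- Syntactic substitution `e[X := g]`. -/
def Expr.subst [DecidableEq V] (X : V) (g : Expr V) : Expr V → Expr V
  | var Y => if Y = X then g else var Y
  | const d => const d
  | scale c e => scale c (Expr.subst X g e)
  | add e₁ e₂ => add (Expr.subst X g e₁) (Expr.subst X g e₂)
  | emin e₁ e₂ => emin (Expr.subst X g e₁) (Expr.subst X g e₂)
  | emax e₁ e₂ => emax (Expr.subst X g e₁) (Expr.subst X g e₂)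
  | condL e₁ e₂ e₃ => condL (Expr.subst X g e₁) (Expr.subst X g e₂) (Expr.subst X g e₃)
  | condR e₁ e₂ e₃ => condR (Expr.subst X g e₁) (Expr.subst X g e₂) (Expr.subst X g e₃)
  | eqm e => eqm (Expr.subst X g e)

/-- `(Σ_{(c,X) ∈ cs} c·X) + rest`. -/
def scaledSum (cs : List ({c : ℝ // 0 < c} × V)) (rest : Expr V) : Expr V :=
  cs.foldr (fun p acc => Expr.add (Expr.scale p.1 (Expr.var p.2)) acc) rest

/-- `(Σ_{X ∈ ms} eq-∞(X)) + rest`. -/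
def eqmSum (ms : List V) (rest : Expr V) : Expr V :=
  ms.foldr (fun X acc => Expr.add (Expr.eqm (Expr.var X)) acc) rest

/-- A term of the shape `(Σ_{X∈𝒳'} c^X·X) + (Σ_{X∈𝒳''} eq-∞(X)) + d`
with the variables in each of the two sums pairwise distinct. -/
def IsSimpleTerm (e : Expr V) : Prop :=
  ∃ (cs : List ({c : ℝ // 0 < c} × V)) (ms : List V) (d : EReal),
    (cs.map Prod.snd).Nodup ∧ ms.Nodup ∧ e = scaledSum cs (eqmSum ms (Expr.const d))

/-- Finite disjunction; the empty disjunction is `−∞`. -/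
def disjList : List (Expr V) → Expr V
  | [] => Expr.const ⊥
  | [e] => e
  | e :: es => Expr.emax e (disjList es)

/-- Finite conjunction; the empty conjunction is `∞`. -/
def conjList : List (Expr V) → Expr V
  | [] => Expr.const ⊤
  | [e] => e
  | e :: es => Expr.emin e (conjList es)

/-- Simple conjunctive normal form. -/
def IsSimpleCNF (e : Expr V) : Prop :=
  ∃ ls : List (List (Expr V)),
    (∀ l ∈ ls, ∀ t ∈ l, IsSimpleTerm t) ∧ e = conjList (ls.map disjList)

/-- Simple disjunctive normal form. -/
def IsSimpleDNF (e : Expr V) : Prop :=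
  ∃ ls : List (List (Expr V)),
    (∀ l ∈ ls, ∀ t ∈ l, IsSimpleTerm t) ∧ e = disjList (ls.map conjList)

/-- Conjunctive normal form. -/
inductive IsCNF : Expr V → Prop where
  | simple {e : Expr V} : IsSimpleCNF e → IsCNF e
  | condL {e₁ e₂ e₃ : Expr V} :
      IsSimpleCNF e₁ → IsCNF e₂ → IsCNF e₃ → IsCNF (Expr.condL e₁ e₂ e₃)
  | condR {e₁ e₂ e₃ : Expr V} :
      IsSimpleCNF e₁ → IsCNF e₂ → IsCNF e₃ → IsCNF (Expr.condR e₁ e₂ e₃)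

/-- Disjunctive normal form. -/
inductive IsDNF : Expr V → Prop where
  | simple {e : Expr V} : IsSimpleDNF e → IsDNF e
  | condL {e₁ e₂ e₃ : Expr V} :
      IsSimpleDNF e₁ → IsDNF e₂ → IsDNF e₃ → IsDNF (Expr.condL e₁ e₂ e₃)
  | condR {e₁ e₂ e₃ : Expr V} :
      IsSimpleDNF e₁ → IsDNF e₂ → IsDNF e₃ → IsDNF (Expr.condR e₁ e₂ e₃)

/-- Fixed-point symbols. -/
inductive FP where
  | mu : FP
  | nu : FP

/-- A real equation system: a finite sequence of fixed-point equations `σ X = e`. -/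
abbrev RES (V : Type*) := List (FP × V × Expr V)

/-- The bound variables of a RES. -/
def bnd (E : RES V) : List V := E.map (fun p => p.2.1)

variable [DecidableEq V]

/-- The solution `[[ℰ]]η` of a real equation system. -/
def sol : RES V → (V → EReal) → V → EReal
  | [], η => η
  | (FP.mu, X, e) :: E, η =>
      sol E (Function.update η X
        (sInf {r : EReal | Expr.eval (sol E (Function.update η X r)) e ≤ r}))
  | (FP.nu, X, e) :: E, η =>
      sol E (Function.update η X
        (sSup {r : EReal | r ≤ Expr.eval (sol E (Function.update η X r)) e}))

/-- Equivalence of real equation systems. -/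
def REquiv (E E' : RES V) : Prop :=
  ∀ F : RES V, (∀ Y ∈ bnd F, Y ∉ bnd E ∧ Y ∉ bnd E') →
    ∀ η : V → EReal, sol (E ++ F) η = sol (E' ++ F) η


/-! ### The operations on the extended reals -/

theorem eadd_eq_neg_add_neg (x y : EReal) : eadd x y = -(-x + -y) := by
  unfold eadd
  split_ifs with h
  · rcases h with rfl | rfl <;> simp
  · push Not at h
    rw [EReal.neg_add (.inl (by simpa using h.1)) (.inr (by simpa using h.2)),
      sub_eq_add_neg, neg_neg, neg_neg]

theorem eadd_comm (x y : EReal) : eadd x y = eadd y x := by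
  simp only [eadd_eq_neg_add_neg, add_comm]

theorem eadd_assoc (x y z : EReal) : eadd (eadd x y) z = eadd x (eadd y z) := by
  simp only [eadd_eq_neg_add_neg, neg_neg, add_assoc]

theorem eadd_left_comm (x y z : EReal) : eadd x (eadd y z) = eadd y (eadd x z) := by
  rw [← eadd_assoc, eadd_comm x, eadd_assoc]

theorem eadd_zero (x : EReal) : eadd x 0 = x := by
  simp [eadd_eq_neg_add_neg]

theorem eadd_mono_right (x : EReal) : Monotone (eadd x) := by
  intro y z h
  simp only [eadd_eq_neg_add_neg]
  exact EReal.neg_le_neg_iff.2 (add_le_add_right (EReal.neg_le_neg_iff.2 h) _)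

theorem eadd_mono_left (y : EReal) : Monotone (fun x => eadd x y) := by
  simpa only [eadd_comm _ y] using eadd_mono_right y

theorem mul_eadd (c : {c : ℝ // 0 < c}) (x y : EReal) :
    (c.1 : EReal) * eadd x y = eadd (c.1 * x) (c.1 * y) := by
  simp only [eadd_eq_neg_add_neg, mul_neg, ← neg_mul]
  have h := EReal.left_distrib_of_nonneg_of_ne_top (x := (c.1 : EReal))
    (EReal.coe_nonneg.2 c.2.le) (EReal.coe_ne_top _) (-x) (-y)
  simp only [mul_neg] at h
  simp only [neg_mul, h]

theorem eadd_mul (a b : {c : ℝ // 0 < c}) (x : EReal) :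
    eadd (a.1 * x) (b.1 * x) = ((a.1 + b.1 : ℝ) : EReal) * x := by
  have ha := a.2
  have hb := b.2
  induction x with
  | bot =>
    rw [EReal.coe_mul_bot_of_pos ha, EReal.coe_mul_bot_of_pos hb,
      EReal.coe_mul_bot_of_pos (add_pos ha hb)]
    simp [eadd]
  | top =>
    rw [EReal.coe_mul_top_of_pos ha, EReal.coe_mul_top_of_pos hb,
      EReal.coe_mul_top_of_pos (add_pos ha hb)]
    simp [eadd]
  | coe r =>
    simp only [← EReal.coe_mul, eadd, EReal.coe_ne_top, or_self, if_false]
    rw [← EReal.coe_add, add_mul]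

theorem monotone_scale (c : {c : ℝ // 0 < c}) :
    Monotone (fun x : EReal => (c.1 : EReal) * x) :=
  fun _ _ h => mul_le_mul_of_nonneg_left h (EReal.coe_nonneg.2 c.2.le)

theorem eqNegInfVal_mono : Monotone eqNegInfVal := by
  intro x y h
  unfold eqNegInfVal
  split_ifs <;> simp_all

theorem eqNegInfVal_eqNegInfVal (x : EReal) : eqNegInfVal (eqNegInfVal x) = eqNegInfVal x := by
  unfold eqNegInfVal
  split_ifs <;> simp_all

theorem eadd_eqNegInfVal_self (x : EReal) :
    eadd (eqNegInfVal x) (eqNegInfVal x) = eqNegInfVal x := by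
  unfold eadd eqNegInfVal
  split_ifs <;> simp_all

theorem mul_eqNegInfVal (c : {c : ℝ // 0 < c}) (x : EReal) :
    (c.1 : EReal) * eqNegInfVal x = eqNegInfVal x := by
  unfold eqNegInfVal
  split_ifs
  · exact EReal.coe_mul_bot_of_pos c.2
  · exact EReal.coe_mul_top_of_pos c.2

theorem eqNegInfVal_mul (c : {c : ℝ // 0 < c}) (x : EReal) :
    eqNegInfVal (c.1 * x) = eqNegInfVal x := by
  induction x with
  | bot => rw [EReal.coe_mul_bot_of_pos c.2]
  | top => rw [EReal.coe_mul_top_of_pos c.2]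
  | coe r => simp [eqNegInfVal, ← EReal.coe_mul]

theorem eqNegInfVal_eadd (x y : EReal) :
    eqNegInfVal (eadd x y) =
      (eqNegInfVal x ⊓ eqNegInfVal y) ⊔ (eadd x ⊥ ⊔ eadd y ⊥) := by
  unfold eqNegInfVal eadd
  by_cases hx : x = ⊤ <;> by_cases hy : y = ⊤ <;> by_cases hx' : x = ⊥ <;>
    by_cases hy' : y = ⊥ <;> simp_all [EReal.add_eq_bot_iff]

/-- The value of `(e₁ ⇒ e₂ ◇ e₃)`. -/
def condLVal (x y z : EReal) : EReal := if x ≤ 0 then y ⊓ z else z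

/-- The value of `(e₁ → e₂ ◇ e₃)`. -/
def condRVal (x y z : EReal) : EReal := if x < 0 then y else y ⊔ z

theorem condLVal_mono (y z : EReal) : Monotone (fun x => condLVal x y z) := by
  intro x x' h
  simp only [condLVal]
  split_ifs with h₁ h₂
  · rfl
  · exact inf_le_right
  · exact absurd (h.trans ‹_›) h₁
  · rfl

theorem condRVal_mono (y z : EReal) : Monotone (fun x => condRVal x y z) := by
  intro x x' h
  simp only [condRVal]
  split_ifs with h₁ h₂
  · rfl
  · exact le_sup_left
  · exact absurd (h.trans_lt ‹_›) h₁
  · rfl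

theorem map_condLVal {φ : EReal → EReal} (hφ : Monotone φ) (x y z : EReal) :
    φ (condLVal x y z) = condLVal x (φ y) (φ z) := by
  unfold condLVal
  split_ifs
  · exact hφ.map_inf _ _
  · rfl

theorem map_condRVal {φ : EReal → EReal} (hφ : Monotone φ) (x y z : EReal) :
    φ (condRVal x y z) = condRVal x (φ y) (φ z) := by
  unfold condRVal
  split_ifs
  · rfl
  · exact hφ.map_sup _ _

section NormalForms

variable {W : Type*}

/-! ### Simple terms -/

/-- The functions obtained from constants, scaled variables and `eq-∞` of variables by addition. -/
inductive LinTerm : ((W → EReal) → EReal) → Prop where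
  | const (d : EReal) : LinTerm fun _ => d
  | scale (c : {c : ℝ // 0 < c}) (X : W) : LinTerm fun η => c.1 * η X
  | eqm (X : W) : LinTerm fun η => eqNegInfVal (η X)
  | add {f g : (W → EReal) → EReal} :
      LinTerm f → LinTerm g → LinTerm fun η => eadd (f η) (g η)

theorem LinTerm.smul (c : {c : ℝ // 0 < c}) {f : (W → EReal) → EReal} (hf : LinTerm f) :
    LinTerm fun η => (c.1 : EReal) * f η := by
  induction hf with
  | const d => exact .const _
  | scale a X =>
    convert LinTerm.scale (⟨c.1 * a.1, mul_pos c.2 a.2⟩ : {c : ℝ // 0 < c}) X using 2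
    rw [EReal.coe_mul, mul_assoc]
  | eqm X => simpa only [mul_eqNegInfVal] using LinTerm.eqm X
  | add _ _ hf hg => simpa only [mul_eadd] using hf.add hg

theorem eval_scaledSum_cons (η : W → EReal) (p : {c : ℝ // 0 < c} × W)
    (cs : List ({c : ℝ // 0 < c} × W)) (r : Expr W) :
    (scaledSum (p :: cs) r).eval η = eadd (p.1.1 * η p.2) ((scaledSum cs r).eval η) := rfl

theorem eval_eqmSum_cons (η : W → EReal) (X : W) (ms : List W) (r : Expr W) :
    (eqmSum (X :: ms) r).eval η = eadd (eqNegInfVal (η X)) ((eqmSum ms r).eval η) := rfl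

theorem eval_scaledSum_congr {η : W → EReal} {r r' : Expr W} (v : EReal)
    (h : r'.eval η = eadd v (r.eval η)) (cs : List ({c : ℝ // 0 < c} × W)) :
    (scaledSum cs r').eval η = eadd v ((scaledSum cs r).eval η) := by
  induction cs with
  | nil => exact h
  | cons p cs ih => rw [eval_scaledSum_cons, ih, eval_scaledSum_cons, eadd_left_comm]

theorem eval_eqmSum_congr {η : W → EReal} {r r' : Expr W} (v : EReal)
    (h : r'.eval η = eadd v (r.eval η)) (ms : List W) :
    (eqmSum ms r').eval η = eadd v ((eqmSum ms r).eval η) := by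
  induction ms with
  | nil => exact h
  | cons X ms ih => rw [eval_eqmSum_cons, ih, eval_eqmSum_cons, eadd_left_comm]

theorem eval_scaledSum_merge (η : W → EReal) (a b : {c : ℝ // 0 < c}) (X : W)
    (l₁ l₂ : List ({c : ℝ // 0 < c} × W)) (r : Expr W) :
    (scaledSum (l₁ ++ (⟨a.1 + b.1, add_pos a.2 b.2⟩, X) :: l₂) r).eval η =
      eadd (a.1 * η X) ((scaledSum (l₁ ++ (b, X) :: l₂) r).eval η) := by
  induction l₁ with
  | nil =>
    simp only [List.nil_append, eval_scaledSum_cons]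
    rw [← eadd_assoc, eadd_mul]
  | cons p l₁ ih =>
    simp only [List.cons_append, eval_scaledSum_cons, ih]
    rw [eadd_left_comm]

theorem eadd_eval_eqmSum_of_mem (η : W → EReal) {X : W} {ms : List W} (hX : X ∈ ms)
    (r : Expr W) :
    eadd (eqNegInfVal (η X)) ((eqmSum ms r).eval η) = (eqmSum ms r).eval η := by
  induction ms with
  | nil => simp at hX
  | cons Y ms ih =>
    rw [eval_eqmSum_cons]
    rcases List.mem_cons.1 hX with rfl | h
    · rw [← eadd_assoc, eadd_eqNegInfVal_self]
    · rw [eadd_left_comm, ih h]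

/-- Adding a term to a simple term yields, semantically, a simple term. -/
theorem LinTerm.exists_isSimpleTerm_add {f : (W → EReal) → EReal} (hf : LinTerm f) {t : Expr W}
    (ht : IsSimpleTerm t) :
    ∃ t', IsSimpleTerm t' ∧ ∀ η, t'.eval η = eadd (f η) (t.eval η) := by
  induction hf generalizing t with
  | const d =>
    obtain ⟨cs, ms, d', hcs, hms, rfl⟩ := ht
    exact ⟨_, ⟨cs, ms, eadd d d', hcs, hms, rfl⟩, fun η =>
      eval_scaledSum_congr d (eval_eqmSum_congr d rfl ms) cs⟩
  | scale a X =>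
    obtain ⟨cs, ms, d, hcs, hms, rfl⟩ := ht
    by_cases hX : X ∈ cs.map Prod.snd
    · obtain ⟨⟨b, Y⟩, hmem, rfl⟩ := List.mem_map.1 hX
      obtain ⟨l₁, l₂, rfl⟩ := List.append_of_mem hmem
      exact ⟨_, ⟨l₁ ++ (⟨a.1 + b.1, add_pos a.2 b.2⟩, Y) :: l₂, ms, d, by simpa using hcs, hms,
        rfl⟩, fun η => eval_scaledSum_merge η a b Y l₁ l₂ _⟩
    · exact ⟨_, ⟨(a, X) :: cs, ms, d, List.nodup_cons.2 ⟨hX, hcs⟩, hms, rfl⟩, fun _ => rfl⟩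
  | eqm X =>
    obtain ⟨cs, ms, d, hcs, hms, rfl⟩ := ht
    by_cases hX : X ∈ ms
    · exact ⟨_, ⟨cs, ms, d, hcs, hms, rfl⟩, fun η =>
        eval_scaledSum_congr _ (eadd_eval_eqmSum_of_mem η hX _).symm cs⟩
    · exact ⟨_, ⟨cs, X :: ms, d, hcs, List.nodup_cons.2 ⟨hX, hms⟩, rfl⟩, fun η =>
        eval_scaledSum_congr _ (eval_eqmSum_cons η X ms _) cs⟩
  | add _ _ ihf ihg =>
    obtain ⟨t₁, ht₁, h₁⟩ := ihg ht
    obtain ⟨t₂, ht₂, h₂⟩ := ihf ht₁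
    exact ⟨t₂, ht₂, fun η => by rw [h₂, h₁, eadd_assoc]⟩

theorem LinTerm.exists_isSimpleTerm {f : (W → EReal) → EReal} (hf : LinTerm f) :
    ∃ t, IsSimpleTerm t ∧ (fun η => t.eval η) = f := by
  obtain ⟨t, ht, h⟩ := hf.exists_isSimpleTerm_add (t := .const 0)
    ⟨[], [], 0, List.nodup_nil, List.nodup_nil, rfl⟩
  exact ⟨t, ht, funext fun η => (h η).trans (eadd_zero _)⟩

/-! ### The lattice generated by the simple terms -/

/-- The lattice of functions generated by the simple terms. -/
def simpleLattice (W : Type*) : Set ((W → EReal) → EReal) := latticeClosure {f | LinTerm f}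

theorem LinTerm.mem_simpleLattice {f : (W → EReal) → EReal} (hf : LinTerm f) :
    f ∈ simpleLattice W := subset_latticeClosure hf

theorem inf_mem_simpleLattice {f g : (W → EReal) → EReal} (hf : f ∈ simpleLattice W)
    (hg : g ∈ simpleLattice W) : (fun η => f η ⊓ g η) ∈ simpleLattice W :=
  isSublattice_latticeClosure.2 hf hg

theorem sup_mem_simpleLattice {f g : (W → EReal) → EReal} (hf : f ∈ simpleLattice W)
    (hg : g ∈ simpleLattice W) : (fun η => f η ⊔ g η) ∈ simpleLattice W :=
  isSublattice_latticeClosure.1 hf hg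

theorem map_mem_simpleLattice {Φ : (W → EReal) → EReal → EReal} (hΦ : ∀ η, Monotone (Φ η))
    (h : ∀ f, LinTerm f → (fun η => Φ η (f η)) ∈ simpleLattice W)
    {f : (W → EReal) → EReal} (hf : f ∈ simpleLattice W) :
    (fun η => Φ η (f η)) ∈ simpleLattice W := by
  have hmin : simpleLattice W ⊆ {f | (fun η => Φ η (f η)) ∈ simpleLattice W} := by
    refine latticeClosure_min h ⟨?_, ?_⟩
    · intro f hf g hg
      simpa [(hΦ _).map_sup] using sup_mem_simpleLattice hf hg
    · intro f hf g hg
      simpa [(hΦ _).map_inf] using inf_mem_simpleLattice hf hg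
  exact hmin hf

theorem scale_mem_simpleLattice (c : {c : ℝ // 0 < c}) {f : (W → EReal) → EReal}
    (hf : f ∈ simpleLattice W) : (fun η => (c.1 : EReal) * f η) ∈ simpleLattice W :=
  map_mem_simpleLattice (Φ := fun _ x => c.1 * x) (fun _ => monotone_scale c)
    (fun _ h => (h.smul c).mem_simpleLattice) hf

theorem eadd_mem_simpleLattice {f g : (W → EReal) → EReal} (hf : f ∈ simpleLattice W)
    (hg : g ∈ simpleLattice W) : (fun η => eadd (f η) (g η)) ∈ simpleLattice W :=
  map_mem_simpleLattice (Φ := fun η x => eadd x (g η)) (fun η => eadd_mono_left (g η))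
    (fun f hf => map_mem_simpleLattice (Φ := fun η y => eadd (f η) y)
      (fun η => eadd_mono_right (f η)) (fun _ hg => (hf.add hg).mem_simpleLattice) hg) hf

theorem LinTerm.eqNegInfVal_mem_simpleLattice {f : (W → EReal) → EReal} (hf : LinTerm f) :
    (fun η => eqNegInfVal (f η)) ∈ simpleLattice W := by
  induction hf with
  | const d => exact (LinTerm.const _).mem_simpleLattice
  | scale c X => simpa only [eqNegInfVal_mul] using (LinTerm.eqm X).mem_simpleLattice
  | eqm X => simpa only [eqNegInfVal_eqNegInfVal] using (LinTerm.eqm X).mem_simpleLattice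
  | add hf hg ihf ihg =>
    simp only [eqNegInfVal_eadd]
    exact sup_mem_simpleLattice (inf_mem_simpleLattice ihf ihg)
      (sup_mem_simpleLattice (hf.add (.const ⊥)).mem_simpleLattice
        (hg.add (.const ⊥)).mem_simpleLattice)

theorem eqNegInfVal_mem_simpleLattice {f : (W → EReal) → EReal} (hf : f ∈ simpleLattice W) :
    (fun η => eqNegInfVal (f η)) ∈ simpleLattice W :=
  map_mem_simpleLattice (Φ := fun _ => eqNegInfVal) (fun _ => eqNegInfVal_mono)
    (fun _ h => h.eqNegInfVal_mem_simpleLattice) hf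

theorem eval_disjList (η : W → EReal) (l : List (Expr W)) :
    (disjList l).eval η = (l.map (Expr.eval η)).foldr (· ⊔ ·) ⊥ := by
  induction l using disjList.induct <;> simp_all [disjList, Expr.eval]

theorem eval_conjList (η : W → EReal) (l : List (Expr W)) :
    (conjList l).eval η = (l.map (Expr.eval η)).foldr (· ⊓ ·) ⊤ := by
  induction l using conjList.induct <;> simp_all [conjList, Expr.eval]

theorem eval_disjList_append (η : W → EReal) (l₁ l₂ : List (Expr W)) :
    (disjList (l₁ ++ l₂)).eval η = (disjList l₁).eval η ⊔ (disjList l₂).eval η := by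
  simp only [eval_disjList]
  induction l₁ <;> simp_all [sup_assoc]

theorem eval_conjList_append (η : W → EReal) (l₁ l₂ : List (Expr W)) :
    (conjList (l₁ ++ l₂)).eval η = (conjList l₁).eval η ⊓ (conjList l₂).eval η := by
  simp only [eval_conjList]
  induction l₁ <;> simp_all [inf_assoc]

theorem exists_disjList_of_mem_supClosure {ι : Type*} {S : Set ((W → EReal) → EReal)}
    {P : ι → Prop} {F : ι → Expr W} (hS : ∀ f ∈ S, ∃ i, P i ∧ (fun η => (F i).eval η) = f)
    {f : (W → EReal) → EReal} (hf : f ∈ supClosure S) :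
    ∃ l : List ι, (∀ i ∈ l, P i) ∧ (fun η => (disjList (l.map F)).eval η) = f := by
  have hmin : supClosure S ⊆ {f | ∃ l : List ι, (∀ i ∈ l, P i) ∧
      (fun η => (disjList (l.map F)).eval η) = f} := by
    refine supClosure_min (fun f hf => ?_) ?_
    · obtain ⟨i, hi, rfl⟩ := hS f hf
      exact ⟨[i], by simpa using hi, rfl⟩
    · rintro _ ⟨l₁, h₁, rfl⟩ _ ⟨l₂, h₂, rfl⟩
      refine ⟨l₁ ++ l₂, fun i hi => (List.mem_append.1 hi).elim (h₁ i) (h₂ i), ?_⟩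
      funext η
      rw [List.map_append, eval_disjList_append]
      rfl
  exact hmin hf

theorem exists_conjList_of_mem_infClosure {ι : Type*} {S : Set ((W → EReal) → EReal)}
    {P : ι → Prop} {F : ι → Expr W} (hS : ∀ f ∈ S, ∃ i, P i ∧ (fun η => (F i).eval η) = f)
    {f : (W → EReal) → EReal} (hf : f ∈ infClosure S) :
    ∃ l : List ι, (∀ i ∈ l, P i) ∧ (fun η => (conjList (l.map F)).eval η) = f := by
  have hmin : infClosure S ⊆ {f | ∃ l : List ι, (∀ i ∈ l, P i) ∧
      (fun η => (conjList (l.map F)).eval η) = f} := by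
    refine infClosure_min (fun f hf => ?_) ?_
    · obtain ⟨i, hi, rfl⟩ := hS f hf
      exact ⟨[i], by simpa using hi, rfl⟩
    · rintro _ ⟨l₁, h₁, rfl⟩ _ ⟨l₂, h₂, rfl⟩
      refine ⟨l₁ ++ l₂, fun i hi => (List.mem_append.1 hi).elim (h₁ i) (h₂ i), ?_⟩
      funext η
      rw [List.map_append, eval_conjList_append]
      rfl
  exact hmin hf

theorem exists_isSimpleCNF {f : (W → EReal) → EReal} (hf : f ∈ simpleLattice W) :
    ∃ e, IsSimpleCNF e ∧ ∀ η, e.eval η = f η := by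
  rw [simpleLattice, ← infClosure_supClosure] at hf
  obtain ⟨ls, hls, rfl⟩ := exists_conjList_of_mem_infClosure
    (P := fun l : List (Expr W) => ∀ t ∈ l, IsSimpleTerm t) (F := disjList)
    (fun g hg => by
      simpa using exists_disjList_of_mem_supClosure (F := id)
        (fun _ h => LinTerm.exists_isSimpleTerm h) hg) hf
  exact ⟨_, ⟨ls, hls, rfl⟩, fun _ => rfl⟩

theorem exists_isSimpleDNF {f : (W → EReal) → EReal} (hf : f ∈ simpleLattice W) :
    ∃ e, IsSimpleDNF e ∧ ∀ η, e.eval η = f η := by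
  rw [simpleLattice, ← supClosure_infClosure] at hf
  obtain ⟨ls, hls, rfl⟩ := exists_disjList_of_mem_supClosure
    (P := fun l : List (Expr W) => ∀ t ∈ l, IsSimpleTerm t) (F := conjList)
    (fun g hg => by
      simpa using exists_conjList_of_mem_infClosure (F := id)
        (fun _ h => LinTerm.exists_isSimpleTerm h) hg) hf
  exact ⟨_, ⟨ls, hls, rfl⟩, fun _ => rfl⟩

/-! ### Conditionals with simple guards -/

/-- The functions obtained from `simpleLattice` by conditionals with guards in `simpleLattice`. -/
inductive GuardedFun : ((W → EReal) → EReal) → Prop where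
  | simple {f : (W → EReal) → EReal} : f ∈ simpleLattice W → GuardedFun f
  | condL {f g h : (W → EReal) → EReal} : f ∈ simpleLattice W → GuardedFun g → GuardedFun h →
      GuardedFun fun η => condLVal (f η) (g η) (h η)
  | condR {f g h : (W → EReal) → EReal} : f ∈ simpleLattice W → GuardedFun g → GuardedFun h →
      GuardedFun fun η => condRVal (f η) (g η) (h η)

theorem GuardedFun.map {Φ : (W → EReal) → EReal → EReal} (hΦ : ∀ η, Monotone (Φ η))
    (hS : ∀ f ∈ simpleLattice W, GuardedFun fun η => Φ η (f η))
    {f : (W → EReal) → EReal} (hf : GuardedFun f) : GuardedFun fun η => Φ η (f η) := by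
  induction hf with
  | simple h => exact hS _ h
  | condL hf _ _ hg hh => simpa only [map_condLVal (hΦ _)] using GuardedFun.condL hf hg hh
  | condR hf _ _ hg hh => simpa only [map_condRVal (hΦ _)] using GuardedFun.condR hf hg hh

theorem GuardedFun.map₂ {φ : EReal → EReal → EReal} (hl : ∀ y, Monotone fun x => φ x y)
    (hr : ∀ x, Monotone (φ x))
    (hS : ∀ f ∈ simpleLattice W, ∀ g ∈ simpleLattice W,
      (fun η => φ (f η) (g η)) ∈ simpleLattice W)
    {f g : (W → EReal) → EReal} (hf : GuardedFun f) (hg : GuardedFun g) :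
    GuardedFun fun η => φ (f η) (g η) :=
  GuardedFun.map (Φ := fun η x => φ x (g η)) (fun η => hl (g η))
    (fun f hf => GuardedFun.map (Φ := fun η y => φ (f η) y) (fun η => hr (f η))
      (fun g hg => .simple (hS f hf g hg)) hg) hf

theorem guardedFun_eval (e : Expr W) : GuardedFun fun η => e.eval η := by
  induction e with
  | var X =>
    simpa [Expr.eval] using
      GuardedFun.simple (LinTerm.scale ⟨1, one_pos⟩ X).mem_simpleLattice
  | const d => exact .simple (LinTerm.const d).mem_simpleLattice
  | scale c e ih =>
    exact ih.map (Φ := fun _ x => c.1 * x) (fun _ => monotone_scale c)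
      fun _ h => .simple (scale_mem_simpleLattice c h)
  | add e₁ e₂ ih₁ ih₂ =>
    exact ih₁.map₂ eadd_mono_left eadd_mono_right
      (fun _ hf _ hg => eadd_mem_simpleLattice hf hg) ih₂
  | emin e₁ e₂ ih₁ ih₂ =>
    exact ih₁.map₂ (φ := (· ⊓ ·)) (fun y _ _ h => inf_le_inf_right y h)
      (fun x _ _ h => inf_le_inf_left x h) (fun _ hf _ hg => inf_mem_simpleLattice hf hg) ih₂
  | emax e₁ e₂ ih₁ ih₂ =>
    exact ih₁.map₂ (φ := (· ⊔ ·)) (fun y _ _ h => sup_le_sup_right h y)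
      (fun x _ _ h => sup_le_sup_left h x) (fun _ hf _ hg => sup_mem_simpleLattice hf hg) ih₂
  | condL e₁ e₂ e₃ ih₁ ih₂ ih₃ =>
    exact ih₁.map (Φ := fun η x => condLVal x (e₂.eval η) (e₃.eval η))
      (fun _ => condLVal_mono _ _) fun _ h => .condL h ih₂ ih₃
  | condR e₁ e₂ e₃ ih₁ ih₂ ih₃ =>
    exact ih₁.map (Φ := fun η x => condRVal x (e₂.eval η) (e₃.eval η))
      (fun _ => condRVal_mono _ _) fun _ h => .condR h ih₂ ih₃
  | eqm e ih =>
    exact ih.map (Φ := fun _ => eqNegInfVal) (fun _ => eqNegInfVal_mono)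
      fun _ h => .simple (eqNegInfVal_mem_simpleLattice h)

theorem GuardedFun.exists_isCNF {f : (W → EReal) → EReal} (hf : GuardedFun f) :
    ∃ e, IsCNF e ∧ ∀ η, e.eval η = f η := by
  induction hf with
  | simple h =>
    obtain ⟨e, he, heq⟩ := exists_isSimpleCNF h
    exact ⟨e, .simple he, heq⟩
  | condL hf _ _ hg hh =>
    obtain ⟨a, ha, ha'⟩ := exists_isSimpleCNF hf
    obtain ⟨b, hb, hb'⟩ := hg
    obtain ⟨c, hc, hc'⟩ := hh
    exact ⟨_, .condL ha hb hc, fun η => by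
      simp only [Expr.eval, condLVal, ha', hb', hc']⟩
  | condR hf _ _ hg hh =>
    obtain ⟨a, ha, ha'⟩ := exists_isSimpleCNF hf
    obtain ⟨b, hb, hb'⟩ := hg
    obtain ⟨c, hc, hc'⟩ := hh
    exact ⟨_, .condR ha hb hc, fun η => by
      simp only [Expr.eval, condRVal, ha', hb', hc']⟩

theorem GuardedFun.exists_isDNF {f : (W → EReal) → EReal} (hf : GuardedFun f) :
    ∃ e, IsDNF e ∧ ∀ η, e.eval η = f η := by
  induction hf with
  | simple h =>
    obtain ⟨e, he, heq⟩ := exists_isSimpleDNF h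
    exact ⟨e, .simple he, heq⟩
  | condL hf _ _ hg hh =>
    obtain ⟨a, ha, ha'⟩ := exists_isSimpleDNF hf
    obtain ⟨b, hb, hb'⟩ := hg
    obtain ⟨c, hc, hc'⟩ := hh
    exact ⟨_, .condL ha hb hc, fun η => by
      simp only [Expr.eval, condLVal, ha', hb', hc']⟩
  | condR hf _ _ hg hh =>
    obtain ⟨a, ha, ha'⟩ := exists_isSimpleDNF hf
    obtain ⟨b, hb, hb'⟩ := hg
    obtain ⟨c, hc, hc'⟩ := hh
    exact ⟨_, .condR ha hb hc, fun η => by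
      simp only [Expr.eval, condRVal, ha', hb', hc']⟩

end NormalForms

/-- every expression is semantically equal to a conjunctive normal
form and to a disjunctive normal form. -/
theorem normal_form (e : Expr V) :
    (∃ e' : Expr V, IsCNF e' ∧ ∀ η : V → EReal, Expr.eval η e' = Expr.eval η e) ∧
    (∃ e' : Expr V, IsDNF e' ∧ ∀ η : V → EReal, Expr.eval η e' = Expr.eval η e) :=
  ⟨(guardedFun_eval e).exists_isCNF, (guardedFun_eval e).exists_isDNF⟩

end
end RESpaper
end

section
/- Let X be a variable and e, f expressions. Then μ X = e ≡ μ X = f provided that for every valuation η: (1) for the least r ∈ R̂ satisfying r = η[X:=r](e) there exists r' ∈ R̂ with r' ≤ r and r' ≥ η[X:=r'](f); and (2) for the least r ∈ R̂ satisfying r = η[X:=r](f) there exists r' ∈ R̂ with r' ≤ r and r' ≥ η[X:=r'](e). (Such least r exist, since the map r ↦ η[X:=r](e) is monotone on the complete lattice R̂.) -/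
namespace RESpaper

noncomputable section

variable {V : Type*}

variable [DecidableEq V]

theorem eadd_le_eadd {x x' y y' : EReal} (hx : x ≤ x') (hy : y ≤ y') :
    eadd x y ≤ eadd x' y' := by
  unfold eadd
  split_ifs with h h' h'
  · exact le_rfl
  · rcases h with rfl | rfl
    · exact absurd (Or.inl (top_le_iff.mp hx)) h'
    · exact absurd (Or.inr (top_le_iff.mp hy)) h'
  · exact le_top
  · exact add_le_add hx hy

/-- Evaluation of an expression is monotone in the valuation. -/
theorem Expr.eval_mono {W : Type*} (e : Expr W) :
    Monotone fun η : W → EReal => Expr.eval η e := by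
  intro η η' h
  induction e with
  | var X => exact h X
  | const d => exact le_rfl
  | scale c e ih =>
    exact mul_le_mul_of_nonneg_left ih (EReal.coe_nonneg.mpr c.2.le)
  | add e₁ e₂ ih₁ ih₂ => exact eadd_le_eadd ih₁ ih₂
  | emin e₁ e₂ ih₁ ih₂ => exact inf_le_inf ih₁ ih₂
  | emax e₁ e₂ ih₁ ih₂ => exact sup_le_sup ih₁ ih₂
  | condL e₁ e₂ e₃ ih₁ ih₂ ih₃ =>
    simp only [Expr.eval] at ih₁ ih₂ ih₃ ⊢
    split_ifs with h₁ h₂ h₂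
    · exact inf_le_inf ih₂ ih₃
    · exact inf_le_right.trans ih₃
    · exact absurd (ih₁.trans h₂) h₁
    · exact ih₃
  | condR e₁ e₂ e₃ ih₁ ih₂ ih₃ =>
    simp only [Expr.eval] at ih₁ ih₂ ih₃ ⊢
    split_ifs with h₁ h₂ h₂
    · exact ih₂
    · exact ih₂.trans le_sup_left
    · exact absurd (ih₁.trans_lt h₂) h₁
    · exact sup_le_sup ih₂ ih₃
  | eqm e ih => exact eqNegInfVal_mono ih

/-- The solution of a real equation system is monotone in the valuation. -/
theorem sol_mono (E : RES V) : Monotone (sol E) := by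
  induction E with
  | nil => exact monotone_id
  | cons p E ih =>
    obtain ⟨σ, X, e⟩ := p
    intro η η' h
    have hr (r : EReal) : Expr.eval (sol E (Function.update η X r)) e ≤
        Expr.eval (sol E (Function.update η' X r)) e :=
      e.eval_mono (ih (update_le_update_iff.mpr ⟨le_rfl, fun Y _ => h Y⟩))
    cases σ with
    | mu =>
      exact ih (update_le_update_iff.mpr
        ⟨sInf_le_sInf fun r hs => (hr r).trans hs, fun Y _ => h Y⟩)
    | nu =>
      exact ih (update_le_update_iff.mpr
        ⟨sSup_le_sSup fun r hs => le_trans hs (hr r), fun Y _ => h Y⟩)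

theorem sol_apply_of_notMem_bnd {E : RES V} {X : V} (hX : X ∉ bnd E) (η : V → EReal) :
    sol E η X = η X := by
  induction E generalizing η with
  | nil => rfl
  | cons p E ih =>
    obtain ⟨σ, Y, e⟩ := p
    simp only [bnd, List.map_cons, List.mem_cons, not_or] at hX
    cases σ <;> exact (ih hX.2 _).trans (Function.update_of_ne hX.1 _ _)

theorem sInf_sol_le_sInf_sol {X : V} {e f : Expr V}
    (h : ∀ (η : V → EReal) (r : EReal),
      IsLeast {s : EReal | Expr.eval (Function.update η X s) e = s} r →
      ∃ r' : EReal, r' ≤ r ∧ Expr.eval (Function.update η X r') f ≤ r')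
    {F : RES V} (hX : X ∉ bnd F) (η : V → EReal) :
    sInf {r : EReal | Expr.eval (sol F (Function.update η X r)) f ≤ r} ≤
      sInf {r : EReal | Expr.eval (sol F (Function.update η X r)) e ≤ r} := by
  have hupd (ξ : V → EReal) : Monotone (Function.update ξ X) := fun r s hrs =>
    update_le_update_iff.mpr ⟨hrs, fun _ _ => le_rfl⟩
  let g : EReal →o EReal :=
    ⟨fun r => Expr.eval (sol F (Function.update η X r)) e,
      fun r s hrs => e.eval_mono (sol_mono F (hupd η hrs))⟩
  change _ ≤ OrderHom.lfp g
  let ξ := sol F (Function.update η X (OrderHom.lfp g))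
  have hξX : ξ X = OrderHom.lfp g := by
    simp only [ξ, sol_apply_of_notMem_bnd hX, Function.update_self]
  let k : EReal →o EReal :=
    ⟨fun r => Expr.eval (Function.update ξ X r) e, fun r s hrs => e.eval_mono (hupd ξ hrs)⟩
  have hk : OrderHom.lfp k ≤ OrderHom.lfp g := by
    refine OrderHom.lfp_le k (le_of_eq ?_)
    change Expr.eval (Function.update ξ X (OrderHom.lfp g)) e = _
    rw [← hξX, Function.update_eq_self, hξX]
    exact OrderHom.map_lfp g
  obtain ⟨r', hr', hf⟩ := h ξ (OrderHom.lfp k) (OrderHom.isLeast_lfp k)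
  have hle : r' ≤ OrderHom.lfp g := hr'.trans hk
  refine (sInf_le ?_).trans hle
  refine le_trans (f.eval_mono ?_) hf
  refine le_update_iff.mpr ⟨?_, fun Y _ => sol_mono F (hupd η hle) Y⟩
  rw [sol_apply_of_notMem_bnd hX, Function.update_self]

/-- sufficient condition for `μ X = e ≡ μ X = f`. -/
theorem generic1_mu (X : V) (e f : Expr V)
    (h1 : ∀ (η : V → EReal) (r : EReal),
      IsLeast {s : EReal | Expr.eval (Function.update η X s) e = s} r →
      ∃ r' : EReal, r' ≤ r ∧ Expr.eval (Function.update η X r') f ≤ r')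
    (h2 : ∀ (η : V → EReal) (r : EReal),
      IsLeast {s : EReal | Expr.eval (Function.update η X s) f = s} r →
      ∃ r' : EReal, r' ≤ r ∧ Expr.eval (Function.update η X r') e ≤ r') :
    REquiv [(FP.mu, X, e)] [(FP.mu, X, f)] := by
  intro F hF η
  have hX : X ∉ bnd F := fun hmem => (hF X hmem).1 (by simp [bnd])
  simp only [List.cons_append, List.nil_append, sol]
  rw [le_antisymm (sInf_sol_le_sInf_sol h2 hX η) (sInf_sol_le_sInf_sol h1 hX η)]

end
end RESpaper
end
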